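/- arXiv:math/9810076 — 3 statements merged into one kernel-verified Lean document; each statement's English description precedes it below -/
import Mathlib

section
/- Every subset A of a topological space X is the intersection of a preopen set and a preclosed set. Concretely, A = A₁ ∩ A₂ where A₁ = A ∪ (X \ closure(A)) is preopen and A₂ = A ∪ closure(interior(A)) is preclosed. -/
open Set

/-- A set is preopen if it is contained in the interior of its closure. -/
def IsPreopen {X : Type*} [TopologicalSpace X] (S : Set X) : Prop :=
  S ⊆ interior (closure S)

/-- A set is preclosed if its complement is preopen. -/
def IsPreclosed {X : Type*} [TopologicalSpace X] (S : Set X) : Prop :=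
  IsPreopen Sᶜ

theorem Dense.isPreopen {X : Type*} [TopologicalSpace X] {S : Set X} (hS : Dense S) :
    IsPreopen S := by
  simp [IsPreopen, hS.closure_eq]

theorem dense_union_compl_closure {X : Type*} [TopologicalSpace X] (A : Set X) :
    Dense (A ∪ (closure A)ᶜ) := by
  rw [dense_iff_closure_eq, closure_union, eq_univ_iff_forall]
  intro x
  by_cases hx : x ∈ closure A
  · exact Or.inl hx
  · exact Or.inr (subset_closure hx)

theorem isPreopen_inter_interior_closure {X : Type*} [TopologicalSpace X] (B : Set X) :
    IsPreopen (B ∩ interior (closure B)) := by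
  have h : interior (closure B) ⊆ closure (B ∩ interior (closure B)) := fun x hx => by
    rw [inter_comm]
    exact isOpen_interior.inter_closure ⟨hx, interior_subset hx⟩
  exact inter_subset_right.trans (interior_maximal h isOpen_interior)

theorem every_set_is_inter_preopen_preclosed {X : Type*} [TopologicalSpace X] (A : Set X) :
    IsPreopen (A ∪ (closure A)ᶜ) ∧ IsPreclosed (A ∪ closure (interior A)) ∧
      A = (A ∪ (closure A)ᶜ) ∩ (A ∪ closure (interior A)) := by
  refine ⟨(dense_union_compl_closure A).isPreopen, ?_, ?_⟩
  · rw [IsPreclosed, compl_union, ← interior_compl, ← closure_compl]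
    exact isPreopen_inter_interior_closure Aᶜ
  · have h : (closure A)ᶜ ∩ closure (interior A) = ∅ :=
      (disjoint_compl_left.mono_right (closure_mono interior_subset)).inter_eq
    rw [← union_inter_distrib_left, h, union_empty]
end

section
/- For every subset A of a topological space X, the set A ∪ closure(interior(A)) is the smallest preclosed set containing A; that is, it is preclosed, contains A, and is contained in every preclosed superset of A. -/
open Set

theorem isPreclosed_iff_closure_interior_subset {X : Type*} [TopologicalSpace X] {S : Set X} :
    IsPreclosed S ↔ closure (interior S) ⊆ S := by
  rw [IsPreclosed, IsPreopen, closure_compl, interior_compl, compl_subset_compl]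

theorem interior_union_closure_interior_subset {X : Type*} [TopologicalSpace X] (A : Set X) :
    interior (A ∪ closure (interior A)) ⊆ closure (interior A) := by
  intro x hx
  by_contra hxc
  have hsub : interior (A ∪ closure (interior A)) \ closure (interior A) ⊆ interior A :=
    interior_maximal (fun y hy => (interior_subset hy.1).resolve_right hy.2)
      (isOpen_interior.sdiff isClosed_closure)
  exact hxc (subset_closure (hsub ⟨hx, hxc⟩))

theorem union_closure_interior_smallest_preclosed {X : Type*} [TopologicalSpace X] (A : Set X) :
    IsPreclosed (A ∪ closure (interior A)) ∧ A ⊆ A ∪ closure (interior A) ∧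
      ∀ F : Set X, IsPreclosed F → A ⊆ F → A ∪ closure (interior A) ⊆ F := by
  refine ⟨?_, subset_union_left, fun F hF hAF => ?_⟩
  · rw [isPreclosed_iff_closure_interior_subset]
    exact (closure_minimal (interior_union_closure_interior_subset A) isClosed_closure).trans
      subset_union_right
  · exact union_subset hAF ((closure_mono (interior_mono hAF)).trans
      (isPreclosed_iff_closure_interior_subset.mp hF))
end

section
/- Every subset A of a topological space X is β-locally closed, i.e., A is the intersection of a β-open set and a β-closed set. -/
open Set

/-- A set is β-open if it is contained in the closure of the interior of its closure. -/
def IsBetaOpen {X : Type*} [TopologicalSpace X] (S : Set X) : Prop :=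
  S ⊆ closure (interior (closure S))

/-- A set is β-closed if its complement is β-open. -/
def IsBetaClosed {X : Type*} [TopologicalSpace X] (S : Set X) : Prop :=
  IsBetaOpen Sᶜ

theorem Dense.isBetaOpen {X : Type*} [TopologicalSpace X] {S : Set X} (hS : Dense S) :
    IsBetaOpen S := by
  simp [IsBetaOpen, hS.closure_eq]

theorem isBetaClosed_iff {X : Type*} [TopologicalSpace X] {S : Set X} :
    IsBetaClosed S ↔ interior (closure (interior S)) ⊆ S := by
  simp only [IsBetaClosed, IsBetaOpen, closure_compl, interior_compl, compl_subset_compl]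

theorem interior_union_subset_of_isClosed {X : Type*} [TopologicalSpace X] {A C : Set X}
    (hC : IsClosed C) : interior (A ∪ C) ⊆ interior A ∪ C := by
  intro x hx
  by_cases hxC : x ∈ C
  · exact Or.inr hxC
  · refine Or.inl (mem_interior.2 ⟨interior (A ∪ C) \ C, ?_, isOpen_interior.sdiff hC, hx, hxC⟩)
    exact fun y hy => (interior_subset hy.1).resolve_right hy.2

/-- The set `A ∪ interior (closure (interior A))` is the β-closure of `A`. -/
theorem isBetaClosed_union_interior_closure_interior {X : Type*} [TopologicalSpace X]
    (A : Set X) : IsBetaClosed (A ∪ interior (closure (interior A))) := by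
  have h : interior (A ∪ interior (closure (interior A))) ⊆ closure (interior A) :=
    (interior_mono (union_subset_union_right A interior_subset)).trans
      ((interior_union_subset_of_isClosed isClosed_closure).trans
        (union_subset subset_closure Subset.rfl))
  exact isBetaClosed_iff.2
    ((interior_mono (closure_minimal h isClosed_closure)).trans subset_union_right)

theorem dense_union_compl_interior_closure_interior {X : Type*} [TopologicalSpace X]
    (A : Set X) : Dense (A ∪ (interior (closure (interior A)))ᶜ) := by
  intro x
  by_cases hx : x ∈ interior (closure (interior A))
  · exact closure_mono (interior_subset.trans subset_union_left) (interior_subset hx)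
  · exact subset_closure (Or.inr hx)

theorem every_set_betaLocallyClosed {X : Type*} [TopologicalSpace X] (A : Set X) :
    ∃ U F : Set X, IsBetaOpen U ∧ IsBetaClosed F ∧ A = U ∩ F := by
  refine ⟨_, _, (dense_union_compl_interior_closure_interior A).isBetaOpen,
    isBetaClosed_union_interior_closure_interior A, ?_⟩
  rw [← union_inter_distrib_left, compl_inter_self, union_empty]
end
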